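/- For every ε ∈ (0, 1/2) and every function f : {0,1}^n → {±1} whose optimal decision tree size is s ≥ 2, the algorithm BuildTopDownDT(f, ε) terminates, and regardless of how ties are broken it outputs a decision tree of size at most s^{2·log₂(4s/ε)·log₂(1/ε)} + 1; in particular TopDownDTSize(f, ε) ≤ s^{O(log(s/ε)·log(1/ε))}. -/

import Mathlib

/- Common definitions: decision trees, bare trees, influence, and the
   BuildTopDownDT top-down heuristic (modelled as a nondeterministic step
   relation, so that all tie-breakings are covered). -/

noncomputable section

namespace TopDownDT

/-- Influence of variable `i` on a Boolean function over a finite index set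
(`true` codes +1, `false` codes −1). -/
def influence {I : Type} [Fintype I] [DecidableEq I]
    (f : (I → Bool) → Bool) (i : I) : ℝ :=
  ((Finset.univ.filter fun x : I → Bool =>
      f x ≠ f (Function.update x i (!x i))).card : ℝ) / 2 ^ Fintype.card I

/-- Total influence. -/
def totalInfluence {I : Type} [Fintype I] [DecidableEq I]
    (f : (I → Bool) → Bool) : ℝ :=
  ∑ i : I, influence f i

variable {n : ℕ}

/-- Override inputs according to a partial assignment (earlier entries take precedence). -/
def override (π : List (Fin n × Bool)) (x : Fin n → Bool) : Fin n → Bool :=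
  fun i =>
    match π.find? (fun p => decide (p.1 = i)) with
    | some p => p.2
    | none => x i

/-- Restriction of `f` by the partial assignment `π` (as a function on the whole cube;
the fixed coordinates become irrelevant). -/
def restrictList (f : (Fin n → Bool) → Bool) (π : List (Fin n × Bool)) :
    (Fin n → Bool) → Bool :=
  fun x => f (override π x)

/-- Decision trees with ±1 leaves (`true` codes +1, `false` codes −1). -/
inductive DecTree (n : ℕ) : Type
  | leaf : Bool → DecTree n
  | node : Fin n → DecTree n → DecTree n → DecTree n
  deriving DecidableEq

/-- Evaluation of a decision tree. -/
def DecTree.eval : DecTree n → (Fin n → Bool) → Bool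
  | .leaf b, _ => b
  | .node i t0 t1, x => if x i then t1.eval x else t0.eval x

/-- Size (number of leaves) of a decision tree. -/
def DecTree.size : DecTree n → ℕ
  | .leaf _ => 1
  | .node _ t0 t1 => t0.size + t1.size

/-- Depth of a decision tree. -/
def DecTree.depth : DecTree n → ℕ
  | .leaf _ => 0
  | .node _ t0 t1 => max t0.depth t1.depth + 1

/-- Number of queries the tree makes on input `x` (the depth of the leaf reached by `x`). -/
def DecTree.pathLen : DecTree n → (Fin n → Bool) → ℕ
  | .leaf _, _ => 0
  | .node i t0 t1, x => (if x i then t1.pathLen x else t0.pathLen x) + 1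

/-- The optimal decision tree size of `f`: the least size of a decision tree computing `f`. -/
def optSize (f : (Fin n → Bool) → Bool) : ℕ :=
  sInf {s : ℕ | ∃ T : DecTree n, (∀ x, T.eval x = f x) ∧ T.size = s}

/-- Bare trees: decision trees with unlabeled leaves. -/
inductive BareTree (n : ℕ) : Type
  | leaf : BareTree n
  | node : Fin n → BareTree n → BareTree n → BareTree n
  deriving DecidableEq

/-- Size (number of leaves) of a bare tree. -/
def BareTree.size : BareTree n → ℕ
  | .leaf => 1
  | .node _ t0 t1 => t0.size + t1.size

/-- Root-to-leaf paths of a bare tree, recorded as lists of (variable, value) pairs. -/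
def BareTree.leafPaths : BareTree n → List (List (Fin n × Bool))
  | .leaf => [[]]
  | .node i t0 t1 =>
      (t0.leafPaths.map fun p => (i, false) :: p) ++
      (t1.leafPaths.map fun p => (i, true) :: p)

/-- Replace the leaf at the end of the path `π` by the bare tree `t`. -/
def BareTree.replaceLeaf : BareTree n → List (Fin n × Bool) → BareTree n → BareTree n
  | .leaf, [], t => t
  | .leaf, _ :: _, _ => .leaf
  | .node i t0 t1, [], _ => .node i t0 t1
  | .node i t0 t1, p :: ps, t =>
      if p.2 then .node i t0 (t1.replaceLeaf ps t)
      else .node i (t0.replaceLeaf ps t) t1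

/-- The `f`-completion: label each leaf `ℓ` by the sign of `E[f_ℓ]`. -/
def completionAux (f : (Fin n → Bool) → Bool) :
    BareTree n → List (Fin n × Bool) → DecTree n
  | .leaf, π =>
      .leaf (decide (2 ^ n ≤ 2 * (Finset.univ.filter fun x => restrictList f π x = true).card))
  | .node i t0 t1, π =>
      .node i (completionAux f t0 (π ++ [(i, false)]))
              (completionAux f t1 (π ++ [(i, true)]))

/-- The `f`-completion of a bare tree. -/
def completion (f : (Fin n → Bool) → Bool) (T : BareTree n) : DecTree n :=
  completionAux f T []

/-- Fraction of points of the cube on which `f` and `g` disagree. -/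
def errf (f g : (Fin n → Bool) → Bool) : ℝ :=
  ((Finset.univ.filter fun x => f x ≠ g x).card : ℝ) / 2 ^ n

/-- Error of the `f`-completion of a bare tree with respect to `f`. -/
def completionErr (f : (Fin n → Bool) → Bool) (T : BareTree n) : ℝ :=
  errf f (completion f T).eval

/-- Score of the leaf with path `π`: `2^{-|ℓ|} · max_i Inf_i(f_ℓ)`. -/
def leafScore (f : (Fin n → Bool) → Bool) (π : List (Fin n × Bool)) : ℝ :=
  ((1 : ℝ) / 2) ^ π.length * ⨆ i : Fin n, influence (restrictList f π) i

/-- `i` is a most influential variable of `g`. -/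
def IsMaxInfl (g : (Fin n → Bool) → Bool) (i : Fin n) : Prop :=
  ∀ j : Fin n, influence g j ≤ influence g i

/-- One step of BuildTopDownDT: replace a maximum-score leaf by a query to a most
influential variable of the corresponding restriction of `f`. -/
def SplitStep (f : (Fin n → Bool) → Bool) (T T' : BareTree n) : Prop :=
  ∃ π ∈ T.leafPaths, ∃ i : Fin n,
    (∀ π' ∈ T.leafPaths, leafScore f π' ≤ leafScore f π) ∧
    IsMaxInfl (restrictList f π) i ∧
    T' = T.replaceLeaf π (.node i .leaf .leaf)

/-- A (partial) run of `BuildTopDownDT(f, ε)` of length `m`, under an arbitrary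
tie-breaking rule: it starts from the single unlabeled leaf and, as long as the
`f`-completion is not an `ε`-approximation of `f`, performs a valid split. -/
def IsRun (f : (Fin n → Bool) → Bool) (ε : ℝ) (m : ℕ) (g : ℕ → BareTree n) : Prop :=
  g 0 = BareTree.leaf ∧
  ∀ j < m, ε < completionErr f (g j) ∧ SplitStep f (g j) (g (j + 1))

/-- Monotonicity of a Boolean function (with `false ≤ true`). -/
def MonotoneBF (f : (Fin n → Bool) → Bool) : Prop :=
  ∀ x y : Fin n → Bool, (∀ i, x i ≤ y i) → f x ≤ f y

/-- Cost of a bare tree relative to `f`:  `Σ_ℓ 2^{-|ℓ|} · Inf(f_ℓ)`. -/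
def costf (f : (Fin n → Bool) → Bool) (T : BareTree n) : ℝ :=
  (T.leafPaths.map fun π =>
    ((1 : ℝ) / 2) ^ π.length * totalInfluence (restrictList f π)).sum

/-- Variance of a Boolean function: `4 · Pr[f = −1] · Pr[f = +1]`. -/
def varf (f : (Fin n → Bool) → Bool) : ℝ :=
  4 * (((Finset.univ.filter fun x => f x = false).card : ℝ) / 2 ^ n) *
      (((Finset.univ.filter fun x => f x = true).card : ℝ) / 2 ^ n)

/-- Expectation `E[f(x)]` of a ±1-valued Boolean function over a uniform input. -/
def expVal (f : (Fin n → Bool) → Bool) : ℝ :=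
  (∑ x : Fin n → Bool, if f x then (1 : ℝ) else -1) / 2 ^ n

end TopDownDT

open TopDownDT

namespace TopDownDT

variable {n : ℕ}

/-- Average of a real-valued function over the uniform cube. -/
def avg (h : (Fin n → Bool) → ℝ) : ℝ := (∑ x, h x) / 2 ^ n

lemma avg_mono {h k : (Fin n → Bool) → ℝ} (hk : ∀ x, h x ≤ k x) : avg h ≤ avg k := by
  unfold avg
  gcongr with x
  exact hk x

lemma avg_nonneg {h : (Fin n → Bool) → ℝ} (hh : ∀ x, 0 ≤ h x) : 0 ≤ avg h :=
  div_nonneg (Finset.sum_nonneg fun x _ => hh x) (by positivity)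

lemma avg_add (h k : (Fin n → Bool) → ℝ) : avg (fun x => h x + k x) = avg h + avg k := by
  simp [avg, Finset.sum_add_distrib, add_div]

lemma avg_const_mul (c : ℝ) (h : (Fin n → Bool) → ℝ) : avg (fun x => c * h x) = c * avg h := by
  simp [avg, ← Finset.mul_sum, mul_div_assoc]

lemma avg_const (c : ℝ) : avg (fun _ : Fin n → Bool => c) = c := by
  simp [avg]

lemma avg_ite_eq_card (p : (Fin n → Bool) → Prop) [DecidablePred p] :
    avg (fun x => if p x then (1 : ℝ) else 0) =
      ((Finset.univ.filter p).card : ℝ) / 2 ^ n := by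
  simp [avg]

lemma avg_flip (h : (Fin n → Bool) → ℝ) (i : Fin n) :
    avg (fun x => h (Function.update x i (!x i))) = avg h := by
  unfold avg
  congr 1
  have hinv : Function.Involutive fun x : Fin n → Bool => Function.update x i (!x i) := by
    intro x
    simp
  exact Equiv.sum_comp hinv.toPerm h

lemma avg_update (h : (Fin n → Bool) → ℝ) (i : Fin n) :
    avg h = (avg (fun x => h (Function.update x i false)) +
      avg (fun x => h (Function.update x i true))) / 2 := by
  have key : avg (fun x => h (Function.update x i false) + h (Function.update x i true)) =
      avg (fun x => h x + h (Function.update x i (!x i))) := by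
    congr 1
    funext x
    cases hx : x i
    · have e : Function.update x i false = x := Function.update_eq_self_iff.2 hx.symm
      simp [e]
    · have e : Function.update x i true = x := Function.update_eq_self_iff.2 hx.symm
      simp [e, add_comm]
  rw [avg_add, avg_add, avg_flip] at key
  linarith

lemma influence_eq_avg (g : (Fin n → Bool) → Bool) (i : Fin n) :
    influence g i =
      avg (fun x => if g x ≠ g (Function.update x i (!x i)) then (1 : ℝ) else 0) := by
  rw [avg_ite_eq_card, influence, Fintype.card_fin]

lemma influence_nonneg (g : (Fin n → Bool) → Bool) (i : Fin n) : 0 ≤ influence g i := by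
  unfold influence; positivity

lemma totalInfluence_nonneg (g : (Fin n → Bool) → Bool) : 0 ≤ totalInfluence g :=
  Finset.sum_nonneg fun i _ => influence_nonneg g i

/-- Splitting on a variable lowers the total influence by the influence of that variable. -/
lemma totalInfluence_split (g : (Fin n → Bool) → Bool) (i : Fin n) :
    totalInfluence g = influence g i +
      (totalInfluence (fun x => g (Function.update x i false)) +
        totalInfluence (fun x => g (Function.update x i true))) / 2 := by
  have hterm : ∀ j, influence g j = (if j = i then influence g i else 0) +
      (influence (fun x => g (Function.update x i false)) j +
        influence (fun x => g (Function.update x i true)) j) / 2 := by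
    intro j
    by_cases hj : j = i
    · subst hj
      simp [influence]
    · rw [if_neg hj, zero_add]
      simp only [influence_eq_avg]
      rw [avg_update _ i]
      simp only [Function.update_of_ne hj, Function.update_comm hj]
  unfold totalInfluence
  rw [← Finset.sum_add_distrib, Finset.sum_div]
  conv_rhs => rw [← Finset.sum_ite_eq' Finset.univ i (fun _ => influence g i) |>.trans
    (if_pos (Finset.mem_univ i)), ← Finset.sum_add_distrib]
  exact Finset.sum_congr rfl fun j _ => hterm j

/-- The ±1 value coded by a Boolean. -/
def sgn (b : Bool) : ℝ := if b then 1 else -1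

/-- No path of the tree queries a variable of `S`, or the same variable twice. -/
def DecTree.Fresh : DecTree n → Set (Fin n) → Prop
  | .leaf _, _ => True
  | .node i t0 t1, S => i ∉ S ∧ t0.Fresh (insert i S) ∧ t1.Fresh (insert i S)

/-- Expected depth of the leaf reached by a random walk down the tree. -/
def DecTree.avgDepth : DecTree n → ℝ
  | .leaf _ => 0
  | .node _ t0 t1 => 1 + (t0.avgDepth + t1.avgDepth) / 2

lemma DecTree.Fresh.eval_update {T : DecTree n} {S : Set (Fin n)} (hT : T.Fresh S)
    {i : Fin n} (hi : i ∈ S) (x : Fin n → Bool) (b : Bool) :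
    T.eval (Function.update x i b) = T.eval x := by
  induction T generalizing S with
  | leaf c => rfl
  | node j t0 t1 ih0 ih1 =>
    obtain ⟨hj, h0, h1⟩ := hT
    have hne : j ≠ i := fun h => hj (h ▸ hi)
    simp only [DecTree.eval, Function.update_of_ne hne,
      ih0 h0 (Set.mem_insert_of_mem _ hi), ih1 h1 (Set.mem_insert_of_mem _ hi)]

lemma DecTree.Fresh.node_eval_update_false {i : Fin n} {t0 t1 : DecTree n} {S : Set (Fin n)}
    (hT : (DecTree.node i t0 t1).Fresh S) (x : Fin n → Bool) :
    (DecTree.node i t0 t1).eval (Function.update x i false) = t0.eval x := by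
  simpa [DecTree.eval] using (hT.2.1).eval_update (Set.mem_insert _ _) x false

lemma DecTree.Fresh.node_eval_update_true {i : Fin n} {t0 t1 : DecTree n} {S : Set (Fin n)}
    (hT : (DecTree.node i t0 t1).Fresh S) (x : Fin n → Bool) :
    (DecTree.node i t0 t1).eval (Function.update x i true) = t1.eval x := by
  simpa [DecTree.eval] using (hT.2.2).eval_update (Set.mem_insert _ _) x true

lemma DecTree.size_pos (T : DecTree n) : 0 < T.size := by
  induction T with
  | leaf c => simp [DecTree.size]
  | node i t0 t1 ih0 ih1 => simp only [DecTree.size]; omega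

lemma DecTree.avgDepth_le_logb_size (T : DecTree n) : T.avgDepth ≤ Real.logb 2 T.size := by
  induction T with
  | leaf c => simp [DecTree.avgDepth, DecTree.size]
  | node i t0 t1 ih0 ih1 =>
    have h0 : (0 : ℝ) < t0.size := by exact_mod_cast t0.size_pos
    have h1 : (0 : ℝ) < t1.size := by exact_mod_cast t1.size_pos
    have key : Real.logb 2 (2 ^ 2 * (t0.size * t1.size)) ≤
        Real.logb 2 ((t0.size + t1.size) ^ 2) :=
      Real.logb_le_logb_of_le (by norm_num) (by positivity)
        (by nlinarith [sq_nonneg ((t0.size : ℝ) - t1.size)])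
    rw [Real.logb_mul (by positivity) (by positivity), Real.logb_mul h0.ne' h1.ne',
      Real.logb_pow, Real.logb_pow, Real.logb_self_eq_one (by norm_num)] at key
    simp only [DecTree.avgDepth, DecTree.size]
    push_cast at key ⊢
    linarith

/-- A two-function form of the O'Donnell–Saks–Schramm–Servedio inequality. -/
lemma DecTree.Fresh.covariance_le {T : DecTree n} {S : Set (Fin n)} (hT : T.Fresh S)
    (g : (Fin n → Bool) → Bool) {M : ℝ} (hM : ∀ i, influence g i ≤ M) :
    avg (fun x => sgn (T.eval x) * sgn (g x)) ≤
      avg (fun x => sgn (T.eval x)) * avg (fun x => sgn (g x)) + T.avgDepth * M := by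
  induction T generalizing S with
  | leaf c => simp [DecTree.eval, DecTree.avgDepth, avg_const_mul, avg_const]
  | node i t0 t1 ih0 ih1 =>
    have e1 := avg_update (fun x => sgn ((DecTree.node i t0 t1).eval x) * sgn (g x)) i
    have e2 := avg_update (fun x => sgn ((DecTree.node i t0 t1).eval x)) i
    simp only [hT.node_eval_update_false, hT.node_eval_update_true] at e1 e2
    have hpt : avg (fun x => sgn (t0.eval x) * sgn (g (Function.update x i false)) +
          sgn (t1.eval x) * sgn (g (Function.update x i true))) ≤
        avg (fun x => (sgn (t0.eval x) * sgn (g x) + sgn (t1.eval x) * sgn (g x)) +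
          2 * (if g x ≠ g (Function.update x i (!x i)) then (1 : ℝ) else 0)) := by
      apply avg_mono
      intro x
      cases hx : x i
      · have e : Function.update x i false = x := Function.update_eq_self_iff.2 hx.symm
        rw [e, Bool.not_false]
        cases t0.eval x <;> cases t1.eval x <;> cases g x <;>
          cases g (Function.update x i true) <;> norm_num [sgn]
      · have e : Function.update x i true = x := Function.update_eq_self_iff.2 hx.symm
        rw [e, Bool.not_true]
        cases t0.eval x <;> cases t1.eval x <;> cases g x <;>
          cases g (Function.update x i false) <;> norm_num [sgn]
    rw [avg_add, avg_add, avg_add, avg_const_mul, ← influence_eq_avg] at hpt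
    have h0 := ih0 hT.2.1
    have h1 := ih1 hT.2.2
    have hi := hM i
    rw [e1, e2, DecTree.avgDepth]
    linarith

/-- The average number of sensitive coordinates, counted at the inputs of value `c` only. -/
def edgeOut (c : Bool) (g : (Fin n → Bool) → Bool) : ℝ :=
  ∑ j, avg fun x =>
    if g x = c ∧ g (Function.update x j (!x j)) ≠ c then (1 : ℝ) else 0

lemma totalInfluence_eq_two_mul_edgeOut (c : Bool) (g : (Fin n → Bool) → Bool) :
    totalInfluence g = 2 * edgeOut c g := by
  unfold totalInfluence edgeOut
  rw [Finset.mul_sum]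
  refine Finset.sum_congr rfl fun j _ => ?_
  rw [influence_eq_avg, two_mul]
  nth_rewrite 2 [← avg_flip _ j]
  rw [← avg_add]
  congr 1
  funext x
  simp only [Function.update_self, Function.update_idem, Bool.not_not, Function.update_eq_self]
  cases g x <;> cases g (Function.update x j (!x j)) <;> cases c <;> simp

lemma DecTree.Fresh.edgeOut_node_le {i : Fin n} {t0 t1 : DecTree n} {S : Set (Fin n)}
    (hT : (DecTree.node i t0 t1).Fresh S) (c : Bool) :
    edgeOut c (DecTree.node i t0 t1).eval ≤
      avg (fun x => if (DecTree.node i t0 t1).eval x = c then (1 : ℝ) else 0) +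
        (edgeOut c t0.eval + edgeOut c t1.eval) / 2 := by
  set u := avg (fun x => if (DecTree.node i t0 t1).eval x = c then (1 : ℝ) else 0) with hu
  have hnn : ∀ (t : DecTree n) (j : Fin n), 0 ≤ avg fun x =>
      if t.eval x = c ∧ t.eval (Function.update x j (!x j)) ≠ c then (1 : ℝ) else 0 :=
    fun t j => avg_nonneg fun x => by split_ifs <;> norm_num
  unfold edgeOut
  rw [← Finset.sum_add_distrib, Finset.sum_div]
  conv_rhs => rw [← Finset.sum_ite_eq' Finset.univ i (fun _ => u) |>.trans
    (if_pos (Finset.mem_univ i)), ← Finset.sum_add_distrib]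
  refine Finset.sum_le_sum fun j _ => ?_
  by_cases hj : j = i
  · rw [if_pos hj]
    have hle : avg (fun x => if (DecTree.node i t0 t1).eval x = c ∧
        (DecTree.node i t0 t1).eval (Function.update x j (!x j)) ≠ c then (1 : ℝ) else 0) ≤ u := by
      apply avg_mono
      intro x
      split_ifs with h1 h2 h2
      · exact le_rfl
      · exact absurd h1.1 h2
      · norm_num
      · exact le_rfl
    have h0 := hnn t0 j
    have h1 := hnn t1 j
    linarith
  · rw [if_neg hj, zero_add, avg_update _ i]
    simp only [Function.update_of_ne hj, ← Function.update_comm hj,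
      hT.node_eval_update_false, hT.node_eval_update_true]
    exact le_of_eq rfl

lemma DecTree.Fresh.log_two_mul_edgeOut_le {T : DecTree n} {S : Set (Fin n)} (hT : T.Fresh S)
    (c : Bool) {t : ℝ} (ht : 0 < t) :
    Real.log 2 * edgeOut c T.eval ≤
      T.size * t - avg (fun x => if T.eval x = c then (1 : ℝ) else 0) * (1 + Real.log t) := by
  induction T generalizing S t with
  | leaf b =>
    have hlog := Real.log_le_sub_one_of_pos ht
    by_cases hb : b = c
    · simp [edgeOut, DecTree.eval, DecTree.size, hb, avg_const]
      linarith
    · simp [edgeOut, DecTree.eval, DecTree.size, hb, avg_const]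
      linarith
  | node i t0 t1 ih0 ih1 =>
    have hle := hT.edgeOut_node_le c
    have e := avg_update (fun x => if (DecTree.node i t0 t1).eval x = c then (1 : ℝ) else 0) i
    simp only [hT.node_eval_update_false, hT.node_eval_update_true] at e
    have h0 := ih0 hT.2.1 (t := 2 * t) (by positivity)
    have h1 := ih1 hT.2.2 (t := 2 * t) (by positivity)
    rw [Real.log_mul two_ne_zero ht.ne'] at h0 h1
    have hle' := mul_le_mul_of_nonneg_left hle (Real.log_nonneg (one_le_two (α := ℝ)))
    rw [e] at hle' ⊢
    simp only [DecTree.size]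
    push_cast
    linarith

lemma override_append (π : List (Fin n × Bool)) (i : Fin n) (b : Bool) (x : Fin n → Bool) :
    override (π ++ [(i, b)]) x = override π (Function.update x i b) := by
  funext j
  unfold override
  rw [List.find?_append]
  cases h : π.find? (fun p => decide (p.1 = j)) with
  | some p => simp
  | none =>
    by_cases hj : i = j
    · subst hj; simp
    · simp [hj, Function.update_of_ne (Ne.symm hj)]

lemma find?_eq_none_of_notMem {π : List (Fin n × Bool)} {i : Fin n} (hi : i ∉ π.map Prod.fst) :
    π.find? (fun p => decide (p.1 = i)) = none := by
  rw [List.find?_eq_none]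
  intro p hp
  rw [decide_eq_true_eq]
  rintro rfl
  exact hi (List.mem_map_of_mem hp)

lemma override_of_notMem {π : List (Fin n × Bool)} {i : Fin n} (hi : i ∉ π.map Prod.fst)
    (x : Fin n → Bool) : override π x i = x i := by
  simp only [override, find?_eq_none_of_notMem hi]

lemma override_update_of_mem {π : List (Fin n × Bool)} {i : Fin n} (hi : i ∈ π.map Prod.fst)
    (x : Fin n → Bool) (b : Bool) : override π (Function.update x i b) = override π x := by
  funext j
  unfold override
  cases h : π.find? (fun p => decide (p.1 = j)) with
  | some p => rfl
  | none =>
    have hj : j ≠ i := by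
      rintro rfl
      obtain ⟨p, hp, rfl⟩ := List.mem_map.1 hi
      simpa using List.find?_eq_none.1 h p hp
    simp [Function.update_of_ne hj]

lemma restrictList_append (f : (Fin n → Bool) → Bool) (π : List (Fin n × Bool)) (i : Fin n)
    (b : Bool) :
    restrictList f (π ++ [(i, b)]) = fun x => restrictList f π (Function.update x i b) := by
  funext x
  simp [restrictList, override_append]

lemma influence_restrictList_of_mem (f : (Fin n → Bool) → Bool) {π : List (Fin n × Bool)}
    {i : Fin n} (hi : i ∈ π.map Prod.fst) : influence (restrictList f π) i = 0 := by
  simp [influence, restrictList, override_update_of_mem hi]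

/-- The tree restricted by a partial assignment, with redundant queries removed. -/
def DecTree.prune : DecTree n → List (Fin n × Bool) → DecTree n
  | .leaf b, _ => .leaf b
  | .node i t0 t1, π =>
      match π.find? (fun p => decide (p.1 = i)) with
      | some p => if p.2 then t1.prune π else t0.prune π
      | none => .node i (t0.prune (π ++ [(i, false)])) (t1.prune (π ++ [(i, true)]))

lemma DecTree.eval_prune (T : DecTree n) (π : List (Fin n × Bool)) (x : Fin n → Bool) :
    (T.prune π).eval x = T.eval (override π x) := by
  induction T generalizing π with
  | leaf b => rfl
  | node i t0 t1 ih0 ih1 =>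
    unfold DecTree.prune
    cases h : π.find? (fun p => decide (p.1 = i)) with
    | some p =>
      have hov : override π x i = p.2 := by simp [override, h]
      cases hp : p.2 <;> simp [DecTree.eval, hov, hp, ih0, ih1]
    | none =>
      have hov : override π x i = x i := by simp [override, h]
      simp only [DecTree.eval, hov, ih0, ih1, override_append]
      cases hx : x i
      · have e : Function.update x i false = x := Function.update_eq_self_iff.2 hx.symm
        simp [e]
      · have e : Function.update x i true = x := Function.update_eq_self_iff.2 hx.symm
        simp [e]

lemma DecTree.size_prune_le (T : DecTree n) (π : List (Fin n × Bool)) :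
    (T.prune π).size ≤ T.size := by
  induction T generalizing π with
  | leaf b => rfl
  | node i t0 t1 ih0 ih1 =>
    unfold DecTree.prune
    cases h : π.find? (fun p => decide (p.1 = i)) with
    | some p =>
      have h0 := ih0 π
      have h1 := ih1 π
      cases hp : p.2 <;> simp only [hp, DecTree.size] <;> simp <;> omega
    | none => exact Nat.add_le_add (ih0 _) (ih1 _)

lemma DecTree.fresh_prune (T : DecTree n) (π : List (Fin n × Bool)) :
    (T.prune π).Fresh {j | j ∈ π.map Prod.fst} := by
  induction T generalizing π with
  | leaf b => trivial
  | node i t0 t1 ih0 ih1 =>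
    unfold DecTree.prune
    cases h : π.find? (fun p => decide (p.1 = i)) with
    | some p =>
      cases hp : p.2
      · simpa [hp] using ih0 π
      · simpa [hp] using ih1 π
    | none =>
      have hins : ∀ b : Bool, {j | j ∈ (π ++ [(i, b)]).map Prod.fst} =
          insert i {j | j ∈ π.map Prod.fst} := by
        intro b
        ext j
        simp only [List.map_append, List.mem_append, Set.mem_ofPred_eq, Set.mem_insert_iff,
          List.map_cons, List.map_nil, List.mem_singleton]
        tauto
      refine ⟨?_, ?_, ?_⟩
      · intro hi
        obtain ⟨p, hp, rfl⟩ := List.mem_map.1 hi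
        simpa using List.find?_eq_none.1 h p hp
      · rw [← hins false]; exact ih0 _
      · rw [← hins true]; exact ih1 _

/-- The label given by the completion to a leaf whose restricted function is `g`. -/
def majority (g : (Fin n → Bool) → Bool) : Bool :=
  decide (2 ^ n ≤ 2 * (Finset.univ.filter fun x => g x = true).card)

/-- Probability of disagreeing with the majority value. -/
def missProb (g : (Fin n → Bool) → Bool) : ℝ :=
  avg fun x => if g x = !majority g then (1 : ℝ) else 0

lemma missProb_nonneg (g : (Fin n → Bool) → Bool) : 0 ≤ missProb g :=
  avg_nonneg fun x => by split_ifs <;> norm_num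

lemma avg_eq_add_avg_eq_not (g : (Fin n → Bool) → Bool) (c : Bool) :
    avg (fun x => if g x = c then (1 : ℝ) else 0) +
      avg (fun x => if g x = !c then (1 : ℝ) else 0) = 1 := by
  rw [← avg_add]
  refine Eq.trans ?_ (avg_const (n := n) 1)
  congr 1
  funext x
  cases g x <;> cases c <;> simp

lemma missProb_le_half (g : (Fin n → Bool) → Bool) : missProb g ≤ 1 / 2 := by
  have hsum := avg_eq_add_avg_eq_not g true
  have hcard := avg_ite_eq_card (fun x => g x = true)
  have hpow : (0 : ℝ) < 2 ^ n := by positivity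
  unfold missProb
  by_cases h : 2 ^ n ≤ 2 * (Finset.univ.filter fun x => g x = true).card
  · have hm : majority g = true := decide_eq_true h
    have h' : (2 : ℝ) ^ n ≤ 2 * ((Finset.univ.filter fun x => g x = true).card : ℝ) := by
      exact_mod_cast h
    have : 1 / 2 ≤ avg (fun x => if g x = true then (1 : ℝ) else 0) := by
      rw [hcard, le_div_iff₀ hpow]; linarith
    rw [hm]
    linarith
  · have hm : majority g = false := decide_eq_false h
    have h' : 2 * ((Finset.univ.filter fun x => g x = true).card : ℝ) < (2 : ℝ) ^ n := by
      exact_mod_cast not_le.1 h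
    rw [hm, Bool.not_false, hcard, div_le_iff₀ hpow]
    linarith

lemma two_mul_missProb_le (g : (Fin n → Bool) → Bool) :
    2 * missProb g ≤ 1 - avg (fun x => sgn (g x)) * avg (fun x => sgn (g x)) := by
  have hp0 := missProb_nonneg g
  have hp1 := missProb_le_half g
  have hsum := avg_eq_add_avg_eq_not g (majority g)
  have hexp : avg (fun x => sgn (g x)) = sgn (majority g) *
      avg (fun x => if g x = majority g then (1 : ℝ) else 0) +
      (-sgn (majority g)) * missProb g := by
    rw [missProb, ← avg_const_mul, ← avg_const_mul, ← avg_add]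
    congr 1
    funext x
    cases g x <;> cases majority g <;> simp [sgn]
  have hsq : sgn (majority g) * sgn (majority g) = 1 := by
    cases majority g <;> simp [sgn]
  change _ + missProb g = 1 at hsum
  have hA : avg (fun x => if g x = majority g then (1 : ℝ) else 0) = 1 - missProb g := by
    linarith
  have : avg (fun x => sgn (g x)) * avg (fun x => sgn (g x)) =
      (sgn (majority g) * sgn (majority g)) * (1 - 2 * missProb g) ^ 2 := by
    rw [hexp, hA]; ring
  rw [this, hsq]
  nlinarith

lemma BareTree.leafPaths_ne_nil (T : BareTree n) : T.leafPaths ≠ [] := by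
  induction T with
  | leaf => simp [BareTree.leafPaths]
  | node i t0 t1 ih0 ih1 => simp [BareTree.leafPaths, ih0]

lemma BareTree.length_leafPaths (T : BareTree n) : T.leafPaths.length = T.size := by
  induction T with
  | leaf => rfl
  | node i t0 t1 ih0 ih1 => simp [BareTree.leafPaths, BareTree.size, ih0, ih1]

lemma BareTree.sum_weights (T : BareTree n) :
    (T.leafPaths.map fun π => ((1 : ℝ) / 2) ^ π.length).sum = 1 := by
  induction T with
  | leaf => simp [BareTree.leafPaths]
  | node i t0 t1 ih0 ih1 =>
    simp only [BareTree.leafPaths, List.map_append, List.map_map, List.sum_append,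
      Function.comp_def, List.length_cons, pow_succ, List.sum_map_mul_right, ih0, ih1]
    norm_num

lemma BareTree.perm_leafPaths_replaceLeaf (T : BareTree n) {π : List (Fin n × Bool)}
    (hπ : π ∈ T.leafPaths) (i : Fin n) :
    (π :: (T.replaceLeaf π (.node i .leaf .leaf)).leafPaths).Perm
      ((π ++ [(i, false)]) :: (π ++ [(i, true)]) :: T.leafPaths) := by
  induction T generalizing π with
  | leaf =>
    obtain rfl : π = [] := by simpa [BareTree.leafPaths] using hπ
    simp only [BareTree.replaceLeaf, BareTree.leafPaths, List.nil_append, List.map_cons,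
      List.map_nil, List.cons_append]
    exact (List.Perm.swap _ _ _).trans (List.Perm.cons _ (List.Perm.swap _ _ _))
  | node j t0 t1 ih0 ih1 =>
    simp only [BareTree.leafPaths, List.mem_append, List.mem_map] at hπ
    rcases hπ with ⟨ρ, hρ, rfl⟩ | ⟨ρ, hρ, rfl⟩
    · have h := ((ih0 hρ).map fun p => (j, false) :: p).append_right
        (t1.leafPaths.map fun p => (j, true) :: p)
      simpa [BareTree.replaceLeaf, BareTree.leafPaths] using h
    · have h := ((ih1 hρ).map fun p => (j, true) :: p).append_left
        (t0.leafPaths.map fun p => (j, false) :: p)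
      simp only [BareTree.replaceLeaf, BareTree.leafPaths, if_true, List.map_cons,
        List.cons_append] at h ⊢
      refine List.perm_middle.symm.trans (h.trans ?_)
      exact List.perm_middle.trans (List.Perm.cons _ List.perm_middle)

/-- On no root-to-leaf path is a variable queried twice. -/
def BareTree.ReadOnce (T : BareTree n) : Prop :=
  ∀ π ∈ T.leafPaths, (π.map Prod.fst).Nodup

/-- Leaf-weighted probability of disagreeing with the majority values at the leaves. -/
def leafErr (f : (Fin n → Bool) → Bool) (T : BareTree n) : ℝ :=
  (T.leafPaths.map fun π => ((1 : ℝ) / 2) ^ π.length * missProb (restrictList f π)).sum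

lemma avg_completionAux_ne (f : (Fin n → Bool) → Bool) (T : BareTree n)
    (π : List (Fin n × Bool)) (hT : ∀ ρ ∈ T.leafPaths, ((π ++ ρ).map Prod.fst).Nodup) :
    avg (fun x => if f (override π x) ≠ (completionAux f T π).eval (override π x)
      then (1 : ℝ) else 0) =
    (T.leafPaths.map fun ρ =>
      ((1 : ℝ) / 2) ^ ρ.length * missProb (restrictList f (π ++ ρ))).sum := by
  induction T generalizing π with
  | leaf =>
    simp only [BareTree.leafPaths, List.map_cons, List.map_nil, List.sum_cons, List.sum_nil,
      List.length_nil, pow_zero, one_mul, add_zero, List.append_nil, missProb]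
    congr 1
    funext x
    change (if restrictList f π x ≠ majority (restrictList f π) then (1 : ℝ) else 0) = _
    cases restrictList f π x <;> cases majority (restrictList f π) <;> simp
  | node i t0 t1 ih0 ih1 =>
    have hi : i ∉ π.map Prod.fst := by
      obtain ⟨ρ, hρ⟩ := List.exists_mem_of_ne_nil _ t0.leafPaths_ne_nil
      have h := hT ((i, false) :: ρ) (by simp [BareTree.leafPaths, hρ])
      rw [List.map_append, List.nodup_append] at h
      exact fun hmem => h.2.2 i hmem i (by simp) rfl
    have h0 := ih0 (π ++ [(i, false)]) fun ρ hρ => by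
      simpa using hT ((i, false) :: ρ) (by simp [BareTree.leafPaths, hρ])
    have h1 := ih1 (π ++ [(i, true)]) fun ρ hρ => by
      simpa using hT ((i, true) :: ρ) (by simp [BareTree.leafPaths, hρ])
    simp only [override_append] at h0 h1
    rw [avg_update _ i]
    simp only [completionAux, DecTree.eval, override_of_notMem hi, Function.update_self,
      if_true, Bool.false_eq_true, if_false]
    rw [h0, h1]
    simp only [BareTree.leafPaths, List.map_append, List.map_map, List.sum_append,
      Function.comp_def, List.length_cons, pow_succ', mul_assoc, List.sum_map_mul_left,
      List.append_assoc, List.cons_append, List.nil_append]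
    ring

lemma completionErr_eq_leafErr (f : (Fin n → Bool) → Bool) {T : BareTree n}
    (hT : T.ReadOnce) : completionErr f T = leafErr f T := by
  have h := avg_completionAux_ne f T [] hT
  rw [avg_ite_eq_card] at h
  exact h

lemma exists_fresh_tree {f : (Fin n → Bool) → Bool} {s : ℕ} (hs : optSize f = s) (hs0 : 0 < s)
    (π : List (Fin n × Bool)) :
    ∃ (T : DecTree n) (S : Set (Fin n)), T.Fresh S ∧ T.size ≤ s ∧ T.eval = restrictList f π := by
  subst hs
  obtain ⟨T, hT, hsize⟩ := Nat.sInf_mem (Nat.nonempty_of_pos_sInf hs0)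
  exact ⟨T.prune π, _, T.fresh_prune π, (T.size_prune_le π).trans hsize.le,
    funext fun x => by rw [T.eval_prune, hT, restrictList]⟩

lemma two_mul_missProb_le_leaf {f : (Fin n → Bool) → Bool} {s : ℕ} (hs : optSize f = s)
    (hs0 : 0 < s) (π : List (Fin n × Bool)) :
    2 * missProb (restrictList f π) ≤
      Real.logb 2 s * ⨆ i, influence (restrictList f π) i := by
  obtain ⟨T, S, hT, hsize, heval⟩ := exists_fresh_tree hs hs0 π
  set M := ⨆ i, influence (restrictList f π) i
  have hM : ∀ i, influence (restrictList f π) i ≤ M :=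
    fun i => le_ciSup (Set.finite_range _).bddAbove i
  have hM0 : 0 ≤ M := Real.iSup_nonneg fun i => influence_nonneg _ i
  have hcov := hT.covariance_le (restrictList f π) hM
  rw [heval] at hcov
  have hone : avg (fun x => sgn (restrictList f π x) * sgn (restrictList f π x)) = 1 := by
    rw [← avg_const (n := n) 1]
    congr 1
    funext x
    cases restrictList f π x <;> simp [sgn]
  have hdepth : T.avgDepth ≤ Real.logb 2 s :=
    T.avgDepth_le_logb_size.trans (Real.logb_le_logb_of_le (by norm_num)
      (by exact_mod_cast T.size_pos) (by exact_mod_cast hsize))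
  have := mul_le_mul_of_nonneg_right hdepth hM0
  have := two_mul_missProb_le (restrictList f π)
  linarith

lemma log_two_mul_totalInfluence_le {f : (Fin n → Bool) → Bool} {s : ℕ} (hs : optSize f = s)
    (hs0 : 0 < s) (π : List (Fin n × Bool)) {t : ℝ} (ht : 0 < t) :
    Real.log 2 * totalInfluence (restrictList f π) ≤
      2 * (s * t - missProb (restrictList f π) * (1 + Real.log t)) := by
  obtain ⟨T, S, hT, hsize, heval⟩ := exists_fresh_tree hs hs0 π
  have h := hT.log_two_mul_edgeOut_le (!majority (restrictList f π)) ht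
  rw [heval] at h
  rw [totalInfluence_eq_two_mul_edgeOut (!majority (restrictList f π))]
  have hst : (T.size : ℝ) * t ≤ s * t := by gcongr
  change _ ≤ _ - missProb (restrictList f π) * _ at h
  linarith

lemma costf_nonneg (f : (Fin n → Bool) → Bool) (T : BareTree n) : 0 ≤ costf f T := by
  apply List.sum_nonneg
  intro a ha
  obtain ⟨π, -, rfl⟩ := List.mem_map.1 ha
  exact mul_nonneg (by positivity) (totalInfluence_nonneg _)

/-- The cost is at most a logarithmic factor larger than the error. -/
lemma costf_le {f : (Fin n → Bool) → Bool} {s : ℕ} (hs : optSize f = s) (hs0 : 0 < s) {ε : ℝ}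
    (hε : 0 < ε) {T : BareTree n} (hT : ε ≤ leafErr f T) :
    costf f T ≤ 2 * leafErr f T * Real.logb 2 (s / ε) := by
  have hs0' : (0 : ℝ) < s := by exact_mod_cast hs0
  set t := ε / (s : ℝ) with ht
  have htpos : 0 < t := by positivity
  have hsum : (T.leafPaths.map fun π => ((1 : ℝ) / 2) ^ π.length *
      totalInfluence (restrictList f π) * Real.log 2).sum ≤
      (T.leafPaths.map fun π => ((1 : ℝ) / 2) ^ π.length * (2 * (s * t)) +
        ((1 : ℝ) / 2) ^ π.length * missProb (restrictList f π) *
          (-(2 * (1 + Real.log t)))).sum := by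
    apply List.sum_le_sum
    intro π _
    have h := mul_le_mul_of_nonneg_left (log_two_mul_totalInfluence_le hs hs0 π htpos)
      (by positivity : (0 : ℝ) ≤ (1 / 2) ^ π.length)
    linarith
  rw [List.sum_map_add, List.sum_map_mul_right, List.sum_map_mul_right, List.sum_map_mul_right,
    T.sum_weights] at hsum
  change costf f T * _ ≤ _ + leafErr f T * _ at hsum
  have hst : (s : ℝ) * t = ε := by rw [ht]; field_simp
  have hlog : Real.log (s / ε) = -Real.log t := by
    rw [ht, ← Real.log_inv, inv_div]
  have hlog2 : 0 < Real.log 2 := Real.log_pos one_lt_two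
  rw [Real.logb, hlog, mul_div_assoc', le_div_iff₀ hlog2]
  rw [hst] at hsum
  nlinarith

/-- The maximum score is at least the average one. -/
lemma two_mul_leafErr_le {f : (Fin n → Bool) → Bool} {s : ℕ} (hs : optSize f = s) (hs0 : 0 < s)
    {T : BareTree n} {π : List (Fin n × Bool)}
    (hmax : ∀ π' ∈ T.leafPaths, leafScore f π' ≤ leafScore f π) :
    2 * leafErr f T ≤ T.size * (Real.logb 2 s * leafScore f π) := by
  have hL : 0 ≤ Real.logb 2 (s : ℝ) :=
    Real.logb_nonneg (by norm_num) (by exact_mod_cast hs0)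
  have h := List.sum_le_card_nsmul
    (T.leafPaths.map fun ρ => 2 * (((1 : ℝ) / 2) ^ ρ.length * missProb (restrictList f ρ)))
    (Real.logb 2 s * leafScore f π) (by
      intro a ha
      obtain ⟨ρ, hρ, rfl⟩ := List.mem_map.1 ha
      refine le_trans ?_ (mul_le_mul_of_nonneg_left (hmax ρ hρ) hL)
      have h := mul_le_mul_of_nonneg_left (two_mul_missProb_le_leaf hs hs0 ρ)
        (by positivity : (0 : ℝ) ≤ (1 / 2) ^ ρ.length)
      simp only [leafScore]
      linarith)
  rw [List.sum_map_mul_left, List.length_map, T.length_leafPaths, nsmul_eq_mul] at h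
  exact h

lemma sum_map_leafPaths_replaceLeaf (F : List (Fin n × Bool) → ℝ) (T : BareTree n)
    {π : List (Fin n × Bool)} (hπ : π ∈ T.leafPaths) (i : Fin n) :
    F π + ((T.replaceLeaf π (.node i .leaf .leaf)).leafPaths.map F).sum =
      F (π ++ [(i, false)]) + (F (π ++ [(i, true)]) + (T.leafPaths.map F).sum) := by
  simpa using ((T.perm_leafPaths_replaceLeaf hπ i).map F).sum_eq

lemma leafScore_eq_of_isMaxInfl {f : (Fin n → Bool) → Bool} {π : List (Fin n × Bool)} {i : Fin n}
    (hi : IsMaxInfl (restrictList f π) i) :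
    leafScore f π = ((1 : ℝ) / 2) ^ π.length * influence (restrictList f π) i := by
  have : Nonempty (Fin n) := ⟨i⟩
  rw [leafScore, le_antisymm (ciSup_le hi) (le_ciSup (Set.finite_range _).bddAbove i)]

lemma costf_replaceLeaf {f : (Fin n → Bool) → Bool} {T : BareTree n} {π : List (Fin n × Bool)}
    (hπ : π ∈ T.leafPaths) {i : Fin n} (hi : IsMaxInfl (restrictList f π) i) :
    costf f (T.replaceLeaf π (.node i .leaf .leaf)) = costf f T - leafScore f π := by
  have h := sum_map_leafPaths_replaceLeaf (fun π =>
    ((1 : ℝ) / 2) ^ π.length * totalInfluence (restrictList f π)) T hπ i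
  simp only [restrictList_append, List.length_append, List.length_singleton, pow_succ] at h
  rw [totalInfluence_split (restrictList f π) i] at h
  rw [leafScore_eq_of_isMaxInfl hi]
  unfold costf
  linarith

lemma size_replaceLeaf {T : BareTree n} {π : List (Fin n × Bool)} (hπ : π ∈ T.leafPaths)
    (i : Fin n) : (T.replaceLeaf π (.node i .leaf .leaf)).size = T.size + 1 := by
  have h := (T.perm_leafPaths_replaceLeaf hπ i).length_eq
  simp only [List.length_cons, BareTree.length_leafPaths] at h
  omega

lemma readOnce_replaceLeaf {f : (Fin n → Bool) → Bool} {T : BareTree n}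
    {π : List (Fin n × Bool)} (hT : T.ReadOnce) (hπ : π ∈ T.leafPaths) {i : Fin n}
    (hi : IsMaxInfl (restrictList f π) i) (hpos : 0 < leafScore f π) :
    (T.replaceLeaf π (.node i .leaf .leaf)).ReadOnce := by
  have hmem : i ∉ π.map Prod.fst := by
    intro hmem
    rw [leafScore_eq_of_isMaxInfl hi, influence_restrictList_of_mem f hmem, mul_zero] at hpos
    exact hpos.false
  have hnew : ∀ b : Bool, ((π ++ [(i, b)]).map Prod.fst).Nodup := by
    intro b
    rw [List.map_append]
    exact (hT π hπ).append (by simp) (by simpa using hmem)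
  intro ρ hρ
  have h := (T.perm_leafPaths_replaceLeaf hπ i).mem_iff.1 (List.mem_cons_of_mem π hρ)
  rcases List.mem_cons.1 h with rfl | h
  · exact hnew false
  rcases List.mem_cons.1 h with rfl | h
  · exact hnew true
  · exact hT ρ h

/-- The effect of one step of the algorithm: the size grows by one and the cost, shifted by a
constant, shrinks by a factor that depends on the size. -/
lemma SplitStep.progress {f : (Fin n → Bool) → Bool} {s : ℕ} (hs : optSize f = s) (hs2 : 2 ≤ s)
    {ε : ℝ} (hε0 : 0 < ε) (hε1 : ε < 1 / 2) {T T' : BareTree n} (hT : T.ReadOnce)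
    (herr : ε < completionErr f T) (hstep : SplitStep f T T') :
    T'.ReadOnce ∧ T'.size = T.size + 1 ∧
      2 * Real.logb 2 (s / ε) * Real.logb 2 s * T.size * (costf f T' - costf f T) ≤
        -(costf f T + 2 * ε * Real.logb 2 (s / ε)) := by
  obtain ⟨π, hπ, i, hmax, hi, rfl⟩ := hstep
  have hs0 : 0 < s := by omega
  have hs2' : (2 : ℝ) ≤ s := by exact_mod_cast hs2
  rw [completionErr_eq_leafErr f hT] at herr
  have hL : 0 < Real.logb 2 (s : ℝ) := Real.logb_pos (by norm_num) (by linarith)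
  have hd : 0 < Real.logb 2 ((s : ℝ) / ε) :=
    Real.logb_pos (by norm_num) (by rw [lt_div_iff₀ hε0]; linarith)
  have hscore := two_mul_leafErr_le hs hs0 hmax
  have hcost := costf_le hs hs0 hε0 herr.le
  have hpos : 0 < leafScore f π := by
    by_contra hle
    have h := mul_nonneg (Nat.cast_nonneg (α := ℝ) T.size)
      (mul_nonneg hL.le (neg_nonneg.2 (not_lt.1 hle)))
    linarith
  refine ⟨readOnce_replaceLeaf hT hπ hi hpos, size_replaceLeaf hπ i, ?_⟩
  rw [costf_replaceLeaf hπ hi]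
  have h1 := mul_le_mul_of_nonneg_left hscore (by positivity :
    0 ≤ 2 * Real.logb 2 ((s : ℝ) / ε))
  have h2 := mul_le_mul_of_nonneg_left herr.le hd.le
  linarith

/-- Along a run, the logarithm of the size is controlled by the decrease of the cost. -/
lemma IsRun.log_size_le {f : (Fin n → Bool) → Bool} {s : ℕ} (hs : optSize f = s) (hs2 : 2 ≤ s)
    {ε : ℝ} (hε0 : 0 < ε) (hε1 : ε < 1 / 2) {m : ℕ} {g : ℕ → BareTree n}
    (hg : IsRun f ε m g) :
    (g m).ReadOnce ∧ (g m).size = m + 1 ∧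
      2 * Real.logb 2 (s / ε) * Real.logb 2 s *
          Real.log (costf f (g m) + 2 * ε * Real.logb 2 (s / ε)) + Real.log (g m).size ≤
        2 * Real.logb 2 (s / ε) * Real.logb 2 s *
          Real.log (costf f .leaf + 2 * ε * Real.logb 2 (s / ε)) := by
  have hs2' : (2 : ℝ) ≤ s := by exact_mod_cast hs2
  have hL : 0 < Real.logb 2 (s : ℝ) := Real.logb_pos (by norm_num) (by linarith)
  have hd : 0 < Real.logb 2 ((s : ℝ) / ε) :=
    Real.logb_pos (by norm_num) (by rw [lt_div_iff₀ hε0]; linarith)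
  induction m with
  | zero =>
    rw [hg.1]
    simp [BareTree.ReadOnce, BareTree.leafPaths, BareTree.size]
  | succ m ih =>
    obtain ⟨hro, hsize, hlog⟩ := ih ⟨hg.1, fun j hj => hg.2 j (by omega)⟩
    obtain ⟨herr, hstep⟩ := hg.2 m (by omega)
    obtain ⟨hro', hsize', hprog⟩ := hstep.progress hs hs2 hε0 hε1 hro herr
    refine ⟨hro', by omega, ?_⟩
    set d := Real.logb 2 ((s : ℝ) / ε)
    set L := Real.logb 2 (s : ℝ)
    have hk : 0 < 2 * d * L := by positivity
    have hD : 0 < costf f (g m) + 2 * ε * d :=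
      add_pos_of_nonneg_of_pos (costf_nonneg _ _) (by positivity)
    have hD' : 0 < costf f (g (m + 1)) + 2 * ε * d :=
      add_pos_of_nonneg_of_pos (costf_nonneg _ _) (by positivity)
    have hN : (0 : ℝ) < (g m).size := by rw [hsize]; positivity
    have hN' : ((g (m + 1)).size : ℝ) = (g m).size + 1 := by rw [hsize']; push_cast; rfl
    have l1 : Real.log (costf f (g (m + 1)) + 2 * ε * d) - Real.log (costf f (g m) + 2 * ε * d) ≤
        (costf f (g (m + 1)) - costf f (g m)) / (costf f (g m) + 2 * ε * d) := by
      rw [← Real.log_div hD'.ne' hD.ne']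
      refine (Real.log_le_sub_one_of_pos (div_pos hD' hD)).trans (le_of_eq ?_)
      field_simp
      ring
    have l2 : Real.log (g (m + 1)).size - Real.log (g m).size ≤ 1 / (g m).size := by
      rw [hN', ← Real.log_div (by positivity) hN.ne']
      refine (Real.log_le_sub_one_of_pos (by positivity)).trans (le_of_eq ?_)
      field_simp
      ring
    have l3 : 2 * d * L * ((costf f (g (m + 1)) - costf f (g m)) /
        (costf f (g m) + 2 * ε * d)) ≤ -(1 / (g m).size) := by
      rw [mul_div_assoc', div_le_iff₀ hD, ← neg_div, div_mul_eq_mul_div, le_div_iff₀ hN]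
      linarith
    have l4 := mul_le_mul_of_nonneg_left l1 hk.le
    linarith

lemma IsRun.size_le {f : (Fin n → Bool) → Bool} {s : ℕ} (hs : optSize f = s) (hs2 : 2 ≤ s)
    {ε : ℝ} (hε0 : 0 < ε) (hε1 : ε < 1 / 2) {m : ℕ} {g : ℕ → BareTree n}
    (hg : IsRun f ε m g) :
    ((g m).size : ℝ) ≤
      (s : ℝ) ^ (2 * Real.logb 2 (4 * s / ε) * Real.logb 2 (1 / ε)) + 1 := by
  have hs2' : (2 : ℝ) ≤ s := by exact_mod_cast hs2
  have hs0' : (0 : ℝ) < s := by linarith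
  obtain ⟨-, hsize, hlog⟩ := hg.log_size_le hs hs2 hε0 hε1
  rcases Nat.eq_zero_or_pos m with rfl | hm
  · rw [hsize]
    have : (0 : ℝ) < (s : ℝ) ^ (2 * Real.logb 2 (4 * s / ε) * Real.logb 2 (1 / ε)) := by
      positivity
    push_cast
    linarith
  have hlog2 : 0 < Real.log 2 := Real.log_pos one_lt_two
  have hL : 0 < Real.logb 2 (s : ℝ) := Real.logb_pos (by norm_num) (by linarith)
  have hd : 0 < Real.logb 2 ((s : ℝ) / ε) :=
    Real.logb_pos (by norm_num) (by rw [lt_div_iff₀ hε0]; linarith)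
  have hdd : Real.logb 2 ((s : ℝ) / ε) ≤ Real.logb 2 (4 * s / ε) :=
    Real.logb_le_logb_of_le (by norm_num) (by positivity) (by gcongr; linarith)
  have hinv : 0 < Real.logb 2 (1 / ε) :=
    Real.logb_pos (by norm_num) (by rw [lt_div_iff₀ hε0]; linarith)
  set d := Real.logb 2 ((s : ℝ) / ε)
  have hleaf : (BareTree.leaf : BareTree n).ReadOnce := by
    simp [BareTree.ReadOnce, BareTree.leafPaths]
  have herr := (hg.2 0 hm).1
  rw [hg.1, completionErr_eq_leafErr f hleaf] at herr
  have hhalf : leafErr f (BareTree.leaf : BareTree n) ≤ 1 / 2 := by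
    simpa [leafErr, BareTree.leafPaths] using missProb_le_half (restrictList f [])
  have hC0 : costf f .leaf ≤ d := by
    refine (costf_le hs (by omega) hε0 herr.le).trans ?_
    have := mul_le_mul_of_nonneg_right hhalf hd.le
    linarith
  have hCm := costf_nonneg f (g m)
  have hC0' := costf_nonneg f (.leaf : BareTree n)
  have hratio : Real.log (costf f .leaf + 2 * ε * d) -
      Real.log (costf f (g m) + 2 * ε * d) ≤ Real.log (1 / ε) := by
    have h2 : 0 < 2 * ε * d := by positivity
    rw [← Real.log_div (by positivity) (by positivity)]
    apply Real.log_le_log (by positivity)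
    rw [div_le_div_iff₀ (by positivity) hε0]
    have h3 := mul_le_mul_of_nonneg_left hC0 hε0.le
    have h4 := mul_le_mul_of_nonneg_right hε1.le h2.le
    nlinarith
  have hk : 0 ≤ 2 * d * Real.logb 2 (s : ℝ) := by positivity
  have hkey := mul_le_mul_of_nonneg_left hratio hk
  have hN : (0 : ℝ) < (g m).size := by rw [hsize]; positivity
  have hexp : Real.log (g m).size ≤
      2 * Real.logb 2 (4 * s / ε) * Real.logb 2 (1 / ε) * Real.log s := by
    have e : 2 * d * Real.logb 2 (s : ℝ) * Real.log (1 / ε) =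
        2 * d * Real.logb 2 (1 / ε) * Real.log s := by
      simp only [Real.logb]; ring
    have hls : 0 ≤ Real.log (s : ℝ) := Real.log_nonneg (by linarith)
    have : 2 * d * Real.logb 2 (1 / ε) * Real.log s ≤
        2 * Real.logb 2 (4 * s / ε) * Real.logb 2 (1 / ε) * Real.log s := by gcongr
    linarith
  have hfin : ((g m).size : ℝ) ≤
      (s : ℝ) ^ (2 * Real.logb 2 (4 * s / ε) * Real.logb 2 (1 / ε)) := by
    rw [← Real.log_le_log_iff hN (by positivity), Real.log_rpow hs0']
    exact hexp
  linarith

end TopDownDT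

/-- For every `ε ∈ (0, 1/2)` and every `f` with optimal decision tree
size `s ≥ 2`, `BuildTopDownDT(f, ε)` terminates (there is no infinite run), and
regardless of how ties are broken every run produces a tree of size at most
`s^{2·log₂(4s/ε)·log₂(1/ε)} + 1`; in particular
`TopDownDTSize(f, ε) ≤ s^{O(log(s/ε)·log(1/ε))}`. -/
theorem buildTopDownDT_size_upper_bound
    {n : ℕ} (ε : ℝ) (hε0 : 0 < ε) (hε1 : ε < 1 / 2)
    (f : (Fin n → Bool) → Bool) (s : ℕ) (hs : optSize f = s) (hs2 : 2 ≤ s) :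
    (¬ ∃ g : ℕ → BareTree n, g 0 = BareTree.leaf ∧
        ∀ j : ℕ, ε < completionErr f (g j) ∧ SplitStep f (g j) (g (j + 1))) ∧
    (∀ (m : ℕ) (g : ℕ → BareTree n), IsRun f ε m g →
      ((g m).size : ℝ) ≤
        (s : ℝ) ^ (2 * Real.logb 2 (4 * s / ε) * Real.logb 2 (1 / ε)) + 1) := by
  refine ⟨?_, fun m g hg => hg.size_le hs hs2 hε0 hε1⟩
  rintro ⟨g, h0, hstep⟩
  obtain ⟨m, hm⟩ := exists_nat_gt
    ((s : ℝ) ^ (2 * Real.logb 2 (4 * s / ε) * Real.logb 2 (1 / ε)) + 1)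
  have hg : IsRun f ε m g := ⟨h0, fun j _ => hstep j⟩
  have hle := hg.size_le hs hs2 hε0 hε1
  rw [(hg.log_size_le hs hs2 hε0 hε1).2.1] at hle
  push_cast at hle
  linarith
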